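/- Let T and M be positive integers with T ≥ 2M, and let p be a real number with p > 2M − T − 1. Then ∫_{ℂ^{(T−M)×M}} det(Ã^H Ã)^p · det(I_M + Ã^H Ã)^{−(T+p)} dÃ = ( ∏_{m=1}^{M} [Γ(T−m+1) Γ(T+p−m−M+1)] / [Γ(T−m−M+1) Γ(T+p−m+1)] ) · π^{M(T−M)} ∏_{m=1}^{M} (m−1)! / (T−m)!, where the integral is with respect to Lebesgue measure on ℂ^{(T−M)×M} and Γ is Euler's Gamma function. Equivalently, the ratio of this integral to ∫_{ℂ^{(T−M)×M}} det(I_M + Ã^H Ã)^{−T} dÃ equals the p-th moment of the chordal product determinant on Gr(M, ℂ^T). -/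

import Mathlib

open Matrix MeasureTheory

noncomputable instance {m n : ℕ} : MeasureSpace (Matrix (Fin m) (Fin n) ℂ) := by
  unfold Matrix; infer_instance

lemma aux_gauss {ι : Type} [Fintype ι] [Nonempty ι] (p t : ℝ) (hp : 0 < Fintype.card ι + p) (ht : 0 < t) :
    ∫⁻ u : ι → ℂ, ENNReal.ofReal ((∑ i, ‖u i‖^2)^p * Real.exp (-t * ∑ i, ‖u i‖^2)) =
      ENNReal.ofReal (Real.pi ^ (Fintype.card ι) * Real.Gamma (Fintype.card ι + p) /
        Real.Gamma (Fintype.card ι) * t ^ (-(Fintype.card ι + p))) := by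
  set k := Fintype.card ι with hk
  have hk0 : 0 < k := Fintype.card_pos
  let e : (ι → ℂ) ≃L[ℝ] EuclideanSpace ℂ ι := (PiLp.continuousLinearEquiv 2 ℝ (fun _ : ι => ℂ)).symm
  let μ : Measure (EuclideanSpace ℂ ι) := Measure.map e volume
  have : μ.IsAddHaarMeasure := e.isAddHaarMeasure_map volume
  have hnorm : ∀ u : ι → ℂ, ∑ i, ‖u i‖^2 = ‖e u‖^2 := by
    intro u
    rw [EuclideanSpace.norm_sq_eq]; rfl
  have hball : μ (Metric.ball 0 1) = ENNReal.ofReal (Real.pi ^ k / Real.Gamma (k + 1)) := by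
    have h1 := Complex.volume_sum_rpow_lt_one ι (p := 2) (by norm_num)
    have : μ (Metric.ball 0 1) = volume {x : ι → ℂ | ∑ i, ‖x i‖ ^ (2:ℝ) < 1} := by
      rw [show μ = Measure.map e.toHomeomorph.toMeasurableEquiv volume from rfl,
        e.toHomeomorph.toMeasurableEquiv.map_apply]
      congr 1
      ext x
      have := hnorm x
      simp only [Set.mem_preimage, Metric.mem_ball, dist_zero_right, Set.mem_ofPred_eq, Real.rpow_two]
      rw [this]
      change ‖e x‖ < 1 ↔ _
      rw [sq_lt_one_iff₀ (norm_nonneg _)]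
    rw [this, h1]
    congr 2
    · norm_num
      rfl
    · rw [mul_div_assoc, mul_comm, div_mul_cancel₀ _ (by norm_num)]
  have hdim : Module.finrank ℝ (EuclideanSpace ℂ ι) = 2 * k := by
    rw [← e.toLinearEquiv.finrank_eq]
    simp [Module.finrank_pi_fintype, hk, mul_comm]
  have : Nontrivial (EuclideanSpace ℂ ι) := by
    apply Module.nontrivial_of_finrank_pos (R := ℝ); omega
  let F : ℝ → ℝ := fun r => (r^2)^p * Real.exp (-t * r^2)
  have hkey : ∀ r ∈ Set.Ioi (0:ℝ), r ^ (2 * k - 1) • F r = r ^ ((2:ℝ)*k - 1 + 2*p) * Real.exp (-t * r ^ (2:ℝ)) := by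
    intro r hr
    have hr : 0 < r := hr
    simp only [F, smul_eq_mul]
    rw [← mul_assoc, ← Real.rpow_natCast, ← Real.rpow_natCast r 2, ← Real.rpow_mul hr.le,
      ← Real.rpow_add hr]
    have : ((2 * k - 1 : ℕ) : ℝ) = 2 * k - 1 := by
      rw [Nat.cast_sub (by omega)]; push_cast; ring
    rw [this]; norm_num
  have hs : (-1:ℝ) < (2:ℝ)*k - 1 + 2*p := by linarith
  have hint : Integrable (fun x => F ‖x‖) μ := by
    rw [integrable_fun_norm_addHaar, hdim]
    rw [integrableOn_congr_fun hkey measurableSet_Ioi]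
    exact integrableOn_rpow_mul_exp_neg_mul_rpow hs two_pos ht
  have hval : ∫ x, F ‖x‖ ∂μ = Real.pi ^ k * Real.Gamma (k + p) / Real.Gamma k * t ^ (-(k + p)) := by
    rw [integral_fun_norm_addHaar, hdim, setIntegral_congr_fun measurableSet_Ioi hkey,
      integral_rpow_mul_exp_neg_mul_rpow two_pos hs ht, measureReal_def, hball,
      ENNReal.toReal_ofReal (by positivity)]
    rw [show ((2:ℝ)*k - 1 + 2*p + 1)/2 = k + p by ring, show -((2:ℝ)*k - 1 + 2*p + 1)/2 = -(k + p) by ring,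
     Real.Gamma_add_one (by positivity)]
    have : Real.Gamma k ≠ 0 := (Real.Gamma_pos_of_pos (by positivity)).ne'
    simp only [smul_eq_mul, nsmul_eq_mul]
    push_cast
    field_simp
  calc _ = ∫⁻ u : ι → ℂ, ENNReal.ofReal (F ‖e u‖) := by
        simp only [hnorm, F]
    _ = ∫⁻ x, ENNReal.ofReal (F ‖x‖) ∂μ := by
        rw [show μ = Measure.map e.toHomeomorph.toMeasurableEquiv volume from rfl,
          lintegral_map_equiv]; rfl
    _ = _ := by
        rw [← ofReal_integral_eq_lintegral_ofReal hint (Filter.Eventually.of_forall fun x => by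
          simp only [F]; positivity), hval]

lemma aux_gauss0 {ι : Type} [Fintype ι] (t : ℝ) (ht : 0 < t) :
    ∫⁻ u : ι → ℂ, ENNReal.ofReal (Real.exp (-t * ∑ i, ‖u i‖^2)) =
      ENNReal.ofReal (Real.pi ^ (Fintype.card ι) * t ^ (-(Fintype.card ι : ℝ))) := by
  rcases isEmpty_or_nonempty ι with h | h
  · simp [volume_pi]
  · have hc : (0:ℝ) < Fintype.card ι := by exact_mod_cast Fintype.card_pos
    have := aux_gauss (ι := ι) 0 t (by simpa using hc) ht
    simp only [Real.rpow_zero, one_mul, add_zero] at this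
    rw [this, mul_div_assoc, div_self (Real.Gamma_pos_of_pos hc).ne', mul_one]

lemma aux_gauss_split {ι : Type} [Fintype ι] (z : ι → Prop) [DecidablePred z] (p t : ℝ)
    (hz : 0 < Fintype.card {i // z i})
    (hp : 0 < Fintype.card {i // z i} + p) (ht : 0 < t) :
    ∫⁻ u : ι → ℂ, ENNReal.ofReal ((∑ i, if z i then ‖u i‖^2 else 0)^p * Real.exp (-t * ∑ i, ‖u i‖^2)) =
      ENNReal.ofReal (Real.pi ^ (Fintype.card ι) * Real.Gamma (Fintype.card {i // z i} + p) /
        Real.Gamma (Fintype.card {i // z i}) * t ^ (-(Fintype.card ι + p))) := by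
  have : Nonempty {i // z i} := Fintype.card_pos_iff.1 hz
  have h1 := (volume_preserving_piEquivPiSubtypeProd (fun _ : ι => ℂ) z).lintegral_comp_emb
    (MeasurableEquiv.measurableEmbedding _)
    (fun x => ENNReal.ofReal ((∑ i, ‖x.1 i‖^2)^p * Real.exp (-t * ∑ i, ‖x.1 i‖^2)) *
      ENNReal.ofReal (Real.exp (-t * ∑ i, ‖x.2 i‖^2)))
  have h2 : ∀ u : ι → ℂ, ENNReal.ofReal ((∑ i, if z i then ‖u i‖^2 else 0)^p * Real.exp (-t * ∑ i, ‖u i‖^2))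
     = (fun x => ENNReal.ofReal ((∑ i, ‖x.1 i‖^2)^p * Real.exp (-t * ∑ i, ‖x.1 i‖^2)) *
      ENNReal.ofReal (Real.exp (-t * ∑ i, ‖x.2 i‖^2))) ((MeasurableEquiv.piEquivPiSubtypeProd (fun _ : ι => ℂ) z) u) := by
    intro u
    have hs : ∑ i, (if z i then ‖u i‖^2 else 0) = ∑ i : {i // z i}, ‖u i‖^2 := by
      rw [← Finset.sum_filter, ← Finset.sum_subtype_eq_sum_filter]
      simp
    have hs2 : ∑ i, ‖u i‖^2 = ∑ i : {i // z i}, ‖u i‖^2 + ∑ i : {i // ¬ z i}, ‖u i‖^2 :=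
      (Fintype.sum_subtype_add_sum_subtype z fun i => ‖u i‖^2).symm
    have hnn : 0 ≤ ∑ i : {i // z i}, ‖u i‖^2 := by positivity
    change _ = ENNReal.ofReal ((∑ i : {i // z i}, ‖u i‖^2)^p * Real.exp (-t * ∑ i : {i // z i}, ‖u i‖^2)) *
      ENNReal.ofReal (Real.exp (-t * ∑ i : {i // ¬ z i}, ‖u i‖^2))
    rw [← ENNReal.ofReal_mul (by positivity), hs, hs2, mul_add, Real.exp_add, mul_assoc]
  simp_rw [h2]
  rw [h1]
  change ∫⁻ _, _ ∂(Measure.prod volume volume) = _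
  rw [lintegral_prod_mul (f := fun x : {i // z i} → ℂ => ENNReal.ofReal ((∑ i, ‖x i‖^2)^p * Real.exp (-t * ∑ i, ‖x i‖^2)))
     (g := fun x : {i // ¬ z i} → ℂ => ENNReal.ofReal (Real.exp (-t * ∑ i, ‖x i‖^2))) 
     (by fun_prop) (Measurable.aemeasurable (by fun_prop)), aux_gauss p t hp ht, aux_gauss0 t ht,
     ← ENNReal.ofReal_mul (by have := Real.Gamma_pos_of_pos hp; positivity)]
  congr 1
  have hc : Fintype.card ι = Fintype.card {i // z i} + Fintype.card {i // ¬ z i} := by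
    rw [← Fintype.card_sum]; exact Fintype.card_congr (Equiv.sumCompl z).symm
  rw [hc, pow_add, Nat.cast_add, show -(((Fintype.card {i // z i}:ℝ) + Fintype.card {i // ¬ z i}) + p) =
    -(Fintype.card {i // z i} + p) + -(Fintype.card {i // ¬ z i}:ℝ) by ring, Real.rpow_add ht]
  ring

lemma gamma_rep (q s : ℝ) (hq : 0 < q) (hs : 0 < s) :
    ENNReal.ofReal (s ^ (-q)) = ENNReal.ofReal (1 / Real.Gamma q) *
      ∫⁻ t in Set.Ioi (0:ℝ), ENNReal.ofReal (t ^ (q-1) * Real.exp (-s * t)) := by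
  have hG := Real.Gamma_pos_of_pos hq
  have hi : IntegrableOn (fun t : ℝ => t ^ (q-1) * Real.exp (-s * t)) (Set.Ioi 0) := by
    have := integrableOn_rpow_mul_exp_neg_mul_rpow (s := q - 1) (p := 1) (b := s) (by linarith) one_pos hs
    simpa using this
  rw [← ofReal_integral_eq_lintegral_ofReal hi, ← ENNReal.ofReal_mul (by positivity)]
  · congr 1
    have := integral_rpow_mul_exp_neg_mul_rpow (q := q - 1) (p := 1) (b := s) one_pos (by linarith) hs
    simp only [Real.rpow_one] at this
    rw [this]; simp; field_simp
  · filter_upwards [self_mem_ae_restrict measurableSet_Ioi] with t ht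
    have : (0:ℝ) < t := ht
    positivity

lemma aux_K {ι : Type} [Fintype ι] (z : ι → Prop) [DecidablePred z] (p q : ℝ)
    (hz : 0 < Fintype.card {i // z i})
    (hp : 0 < Fintype.card {i // z i} + p) (hq : 0 < q) (hq2 : 0 < q - Fintype.card ι - p) :
    ∫⁻ u : ι → ℂ, ENNReal.ofReal ((∑ i, if z i then ‖u i‖^2 else 0)^p * (1 + ∑ i, ‖u i‖^2)^(-q)) =
      ENNReal.ofReal (Real.pi ^ (Fintype.card ι) * Real.Gamma (Fintype.card {i // z i} + p) *
        Real.Gamma (q - Fintype.card ι - p) /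
        (Real.Gamma (Fintype.card {i // z i}) * Real.Gamma q)) := by
  have hG := Real.Gamma_pos_of_pos hq
  have hG2 := Real.Gamma_pos_of_pos hp
  have hG3 : 0 < Real.Gamma (Fintype.card {i // z i}) := Real.Gamma_pos_of_pos (by exact_mod_cast hz)
  have hnn : ∀ u : ι → ℂ, 0 ≤ ∑ i, if z i then ‖u i‖^2 else 0 := fun u =>
    Finset.sum_nonneg fun i _ => by split_ifs <;> positivity
  have h1 : ∀ u : ι → ℂ, ENNReal.ofReal ((∑ i, if z i then ‖u i‖^2 else 0)^p * (1 + ∑ i, ‖u i‖^2)^(-q)) =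
     ENNReal.ofReal (1 / Real.Gamma q) * ∫⁻ t in Set.Ioi (0:ℝ), ENNReal.ofReal (t ^ (q-1) * Real.exp (-t)) *
      ENNReal.ofReal ((∑ i, if z i then ‖u i‖^2 else 0)^p * Real.exp (-t * ∑ i, ‖u i‖^2)) := by
    intro u
    rw [ENNReal.ofReal_mul (Real.rpow_nonneg (hnn u) _), gamma_rep q _ hq (by positivity), mul_left_comm,
      ← lintegral_const_mul' _ _ ENNReal.ofReal_ne_top]
    congr 1
    refine setLIntegral_congr_fun measurableSet_Ioi fun t ht => ?_
    have ht : (0:ℝ) < t := ht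
    rw [← ENNReal.ofReal_mul (Real.rpow_nonneg (hnn u) _), ← ENNReal.ofReal_mul (by positivity)]
    congr 1
    rw [show -(1 + ∑ i, ‖u i‖^2) * t = -t + -t * ∑ i, ‖u i‖^2 by ring, Real.exp_add]
    ring
  have hm : Measurable (fun x : (ι → ℂ) × ℝ => ENNReal.ofReal (x.2 ^ (q-1) * Real.exp (-x.2)) *
      ENNReal.ofReal ((∑ i, if z i then ‖x.1 i‖^2 else 0)^p * Real.exp (-x.2 * ∑ i, ‖x.1 i‖^2))) := by
    have : Measurable (fun x : (ι → ℂ) × ℝ => ∑ i, if z i then ‖x.1 i‖^2 else 0) := by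
      refine Finset.measurable_sum _ fun i _ => ?_
      split_ifs <;> fun_prop
    fun_prop
  simp_rw [h1]
  rw [lintegral_const_mul' _ _ ENNReal.ofReal_ne_top, lintegral_lintegral_swap (by exact hm.aemeasurable)]
  have h2 : ∀ t ∈ Set.Ioi (0:ℝ), (∫⁻ u : ι → ℂ, ENNReal.ofReal (t ^ (q-1) * Real.exp (-t)) *
      ENNReal.ofReal ((∑ i, if z i then ‖u i‖^2 else 0)^p * Real.exp (-t * ∑ i, ‖u i‖^2))) =
      ENNReal.ofReal (Real.pi ^ (Fintype.card ι) * Real.Gamma (Fintype.card {i // z i} + p) /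
        Real.Gamma (Fintype.card {i // z i})) * ENNReal.ofReal (t ^ ((q - Fintype.card ι - p) - 1) * Real.exp (-1 * t)) := by
    intro t ht
    have ht : (0:ℝ) < t := ht
    rw [lintegral_const_mul' _ _ ENNReal.ofReal_ne_top, aux_gauss_split z p t hz hp ht,
      ← ENNReal.ofReal_mul (by positivity), ← ENNReal.ofReal_mul (by positivity)]
    congr 1
    rw [show (q - Fintype.card ι - p) - 1 = (q - 1) + -(Fintype.card ι + p) by ring, Real.rpow_add ht, neg_one_mul]
    ring
  rw [setLIntegral_congr_fun measurableSet_Ioi h2, lintegral_const_mul' _ _ ENNReal.ofReal_ne_top]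
  have h3 := gamma_rep _ 1 hq2 one_pos
  have hG4 := Real.Gamma_pos_of_pos hq2
  have h4 : ∫⁻ t in Set.Ioi (0:ℝ), ENNReal.ofReal (t ^ ((q - Fintype.card ι - p) - 1) * Real.exp (-1 * t)) =
      ENNReal.ofReal (Real.Gamma (q - Fintype.card ι - p)) := by
    have h5 : ENNReal.ofReal (Real.Gamma (q - Fintype.card ι - p)) * ENNReal.ofReal (1 / Real.Gamma (q - Fintype.card ι - p)) = 1 := by
      rw [← ENNReal.ofReal_mul hG4.le, mul_one_div_cancel hG4.ne', ENNReal.ofReal_one]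
    rw [Real.one_rpow, ENNReal.ofReal_one] at h3
    rw [← one_mul (∫⁻ t in Set.Ioi (0:ℝ), _), ← h5, mul_assoc, ← h3, mul_one]
  rw [h4, ← ENNReal.ofReal_mul (by positivity), ← ENNReal.ofReal_mul (by positivity)]
  congr 1
  field_simp

section helpers
open scoped ComplexOrder

/-- Prepend a column. -/
def colCons {N j : ℕ} (a : Fin N → ℂ) (B : Matrix (Fin N) (Fin j) ℂ) : Matrix (Fin N) (Fin (j+1)) ℂ :=
  Matrix.of fun i => Fin.cons (a i) (B i)

lemma colCons_det_zero {N j : ℕ} (a : Fin N → ℂ) (B : Matrix (Fin N) (Fin j) ℂ)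
    (h : (Bᴴ * B).det = 0) : ((colCons a B)ᴴ * colCons a B).det = 0 := by
  obtain ⟨v, hv, hBv⟩ := Matrix.exists_mulVec_eq_zero_iff.2 h
  rw [Matrix.conjTranspose_mul_self_mulVec_eq_zero] at hBv
  refine Matrix.exists_mulVec_eq_zero_iff.1 ⟨Fin.cons 0 v, ?_, ?_⟩
  · intro h0
    apply hv
    ext i
    have := congrFun h0 i.succ
    simpa using this
  · rw [Matrix.conjTranspose_mul_self_mulVec_eq_zero]
    ext i
    have := congrFun hBv i
    simpa [colCons, Matrix.mulVec, dotProduct, Fin.sum_univ_succ] using this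

lemma colCons_mul_conjTranspose {N j : ℕ} (a : Fin N → ℂ) (B : Matrix (Fin N) (Fin j) ℂ) :
    colCons a B * (colCons a B)ᴴ = Matrix.vecMulVec a (star a) + B * Bᴴ := by
  ext i k
  simp [colCons, Matrix.mul_apply, Fin.sum_univ_succ, Matrix.vecMulVec_apply]

lemma colCons_det {N j : ℕ} (a : Fin N → ℂ) (B : Matrix (Fin N) (Fin j) ℂ)
    (h : (Bᴴ * B).det ≠ 0) : ((colCons a B)ᴴ * colCons a B).det =
      (Bᴴ * B).det * (star a ⬝ᵥ ((1 - B * (Bᴴ * B)⁻¹ * Bᴴ) *ᵥ a)) := by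
  let e : Fin j ⊕ Unit ≃ Fin (j+1) := ((finSuccEquiv j).trans (Equiv.optionEquivSumPUnit _)).symm
  have hu : IsUnit (Bᴴ * B).det := isUnit_iff_ne_zero.2 h
  let _ := Matrix.invertibleOfIsUnitDet _ hu
  have hb : ((colCons a B)ᴴ * colCons a B).submatrix e e =
      Matrix.fromBlocks (Bᴴ * B) (Bᴴ * Matrix.replicateCol Unit a) ((Matrix.replicateCol Unit a)ᴴ * B)
        ((Matrix.replicateCol Unit a)ᴴ * Matrix.replicateCol Unit a) := by
    ext (i | i) (k | k) <;> simp [e, colCons, Matrix.mul_apply]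
  rw [← Matrix.det_submatrix_equiv_self e, hb, Matrix.det_fromBlocks₁₁, Matrix.invOf_eq_nonsing_inv]
  congr 1
  rw [Matrix.det_unique]
  have : (Matrix.replicateCol Unit a)ᴴ * Matrix.replicateCol Unit a - (Matrix.replicateCol Unit a)ᴴ * B * (Bᴴ * B)⁻¹ * (Bᴴ * Matrix.replicateCol Unit a)
    = (Matrix.replicateCol Unit a)ᴴ * ((1 - B * (Bᴴ * B)⁻¹ * Bᴴ) * Matrix.replicateCol Unit a) := by
    simp only [Matrix.sub_mul, Matrix.mul_sub, Matrix.one_mul, Matrix.mul_assoc]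
  rw [this]
  generalize 1 - B * (Bᴴ * B)⁻¹ * Bᴴ = Q
  simp [Matrix.mul_apply, dotProduct, Matrix.mulVec]

lemma spectral_aux {N j : ℕ} (B : Matrix (Fin N) (Fin j) ℂ) :
    ∃ (L : Matrix (Fin N) (Fin N) ℂ) (d : Fin N → ℝ), L * Lᴴ = 1 + B * Bᴴ ∧
      ((Bᴴ * B).det ≠ 0 → Fintype.card {i // d i = 0} = N - j ∧
        Lᴴ * (1 - B * (Bᴴ * B)⁻¹ * Bᴴ) * L = Matrix.diagonal fun i => if d i = 0 then (1:ℂ) else 0) := by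
  have hH : (B * Bᴴ).IsHermitian := Matrix.isHermitian_mul_conjTranspose_self B
  have hps : (B * Bᴴ).PosSemidef := Matrix.posSemidef_self_mul_conjTranspose B
  set d := hH.eigenvalues with hd
  have hd0 : ∀ i, 0 ≤ d i := hps.eigenvalues_nonneg
  set U : Matrix (Fin N) (Fin N) ℂ := (hH.eigenvectorUnitary : Matrix (Fin N) (Fin N) ℂ) with hU
  have hUU : U * Uᴴ = 1 := by
    have := (Matrix.mem_unitaryGroup_iff).1 hH.eigenvectorUnitary.2
    simpa [Matrix.star_eq_conjTranspose] using this
  have hUU' : Uᴴ * U = 1 := by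
    have := (Matrix.mem_unitaryGroup_iff').1 hH.eigenvectorUnitary.2
    simpa [Matrix.star_eq_conjTranspose] using this
  have hspec : B * Bᴴ = U * Matrix.diagonal (fun i => (d i : ℂ)) * Uᴴ := by
    have := hH.spectral_theorem
    rw [Unitary.conjStarAlgAut_apply] at this
    simpa [Matrix.star_eq_conjTranspose, Function.comp_def] using this
  set E : Matrix (Fin N) (Fin N) ℂ := Matrix.diagonal (fun i => ((Real.sqrt (1 + d i) : ℝ) : ℂ)) with hE
  have hEH : Eᴴ = E := by
    simp [hE, Matrix.diagonal_conjTranspose]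
  have hEE : E * E = 1 + Matrix.diagonal (fun i => (d i : ℂ)) := by
    rw [hE, Matrix.diagonal_mul_diagonal, ← Matrix.diagonal_one, Matrix.diagonal_add]
    congr 1
    ext i
    rw [← Complex.ofReal_mul, Real.mul_self_sqrt (by have := hd0 i; linarith)]
    push_cast; rfl
  refine ⟨U * E, d, ?_, fun hdet => ?_⟩
  · rw [Matrix.conjTranspose_mul, hEH, show U * E * (E * Uᴴ) = U * (E * E) * Uᴴ by
      simp only [Matrix.mul_assoc], hEE, Matrix.mul_add, Matrix.add_mul, Matrix.mul_one, hUU, hspec]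
  have hu : IsUnit (Bᴴ * B).det := isUnit_iff_ne_zero.2 hdet
  constructor
  · have h1 := hH.rank_eq_card_non_zero_eigs
    rw [Matrix.rank_self_mul_conjTranspose, ← Matrix.rank_conjTranspose_mul_self,
      Matrix.rank_of_isUnit _ ((Matrix.isUnit_iff_isUnit_det _).2 hu), Fintype.card_fin] at h1
    have h2 := Fintype.card_subtype_compl (fun i => d i = 0)
    have h3 := Fintype.card_subtype_le (fun i => d i = 0)
    rw [Fintype.card_fin] at h2 h3
    change j = Fintype.card {i // ¬ d i = 0} at h1
    omega
  · set C := Uᴴ * B with hC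
    set G := Bᴴ * B with hG
    have hCC : C * Cᴴ = Matrix.diagonal (fun i => (d i : ℂ)) := by
      rw [hC, Matrix.conjTranspose_mul, Matrix.conjTranspose_conjTranspose,
        show Uᴴ * B * (Bᴴ * U) = Uᴴ * (B * Bᴴ) * U by simp only [Matrix.mul_assoc], hspec,
        show Uᴴ * (U * Matrix.diagonal (fun i => (d i : ℂ)) * Uᴴ) * U = (Uᴴ * U) * Matrix.diagonal (fun i => (d i : ℂ)) * (Uᴴ * U) by simp only [Matrix.mul_assoc], hUU']
      simp
    have hCG : Cᴴ * C = G := by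
      rw [hC, Matrix.conjTranspose_mul, Matrix.conjTranspose_conjTranspose,
        show Bᴴ * U * (Uᴴ * B) = Bᴴ * (U * Uᴴ) * B by simp only [Matrix.mul_assoc], hUU, Matrix.mul_one]
    set Q' := 1 - C * G⁻¹ * Cᴴ with hQ'
    have hQ : Uᴴ * (1 - B * G⁻¹ * Bᴴ) * U = Q' := by
      rw [hQ', Matrix.mul_sub, Matrix.sub_mul, Matrix.mul_one, hUU', hC, Matrix.conjTranspose_mul,
        Matrix.conjTranspose_conjTranspose]
      simp only [Matrix.mul_assoc]
    have hQC : Q' * C = 0 := by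
      rw [hQ', Matrix.sub_mul, Matrix.one_mul, Matrix.mul_assoc, hCG, Matrix.mul_assoc,
        Matrix.nonsing_inv_mul _ hu, Matrix.mul_one, sub_self]
    have hQD : Q' * Matrix.diagonal (fun i => (d i : ℂ)) = 0 := by
      rw [← hCC, ← Matrix.mul_assoc, hQC, Matrix.zero_mul]
    have hC0 : ∀ i, d i = 0 → ∀ k, C i k = 0 := by
      intro i hi k
      have h1 : (C * Cᴴ) i i = 0 := by rw [hCC]; simp [hi]
      rw [Matrix.mul_apply] at h1
      have h2 : ∑ k, (‖C i k‖^2 : ℝ) = 0 := by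
        have : ((∑ k, (‖C i k‖^2 : ℝ) : ℝ) : ℂ) = 0 := by
          rw [← h1]
          push_cast
          refine Finset.sum_congr rfl fun k _ => ?_
          rw [Matrix.conjTranspose_apply]
          exact (Complex.mul_conj' _).symm
        exact_mod_cast this
      have h3 := (Finset.sum_eq_zero_iff_of_nonneg (fun k _ => by positivity)).1 h2 k (Finset.mem_univ k)
      simpa using h3
    have hQe : ∀ i k, Q' i k = if d k = 0 then (1 : Matrix (Fin N) (Fin N) ℂ) i k else 0 := by
      intro i k
      split_ifs with hk
      · rw [hQ', Matrix.sub_apply, Matrix.mul_apply]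
        simp [hC0 k hk]
      · have := congrFun (congrFun hQD i) k
        rw [Matrix.mul_diagonal] at this
        simpa [hk] using this
    rw [Matrix.conjTranspose_mul, hEH, show E * Uᴴ * (1 - B * G⁻¹ * Bᴴ) * (U * E) = E * (Uᴴ * (1 - B * G⁻¹ * Bᴴ) * U) * E by
      simp only [Matrix.mul_assoc], hQ]
    ext i k
    rw [hE, Matrix.mul_diagonal, Matrix.diagonal_mul, hQe, Matrix.diagonal_apply, Matrix.one_apply]
    by_cases hik : i = k
    · subst hik
      by_cases hi : d i = 0 <;> simp [hi]
    · simp [hik]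

lemma lintegral_mulVec {N : ℕ} (L : Matrix (Fin N) (Fin N) ℂ) (hL : L.det ≠ 0)
    (f : (Fin N → ℂ) → ENNReal) (hf : Measurable f) :
    ∫⁻ a, f a = ENNReal.ofReal (Complex.normSq L.det) * ∫⁻ w, f (L *ᵥ w) := by
  let l : (Fin N → ℂ) →ₗ[ℝ] (Fin N → ℂ) := (Matrix.toLin' L).restrictScalars ℝ
  have hdet : LinearMap.det l = Complex.normSq L.det := by
    rw [LinearMap.det_restrictScalars, Algebra.norm_complex_apply, LinearMap.det_toLin']
  have hn : 0 < Complex.normSq L.det := Complex.normSq_pos.2 hL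
  have h1 := Measure.map_linearMap_addHaar_eq_smul_addHaar (volume : Measure (Fin N → ℂ)) (f := l)
    (by rw [hdet]; exact hn.ne')
  have h2 : ∫⁻ w, f (L *ᵥ w) = ∫⁻ a, f a ∂(Measure.map l volume) := by
    rw [lintegral_map hf (LinearMap.continuous_of_finiteDimensional l).measurable]
    rfl
  rw [h2, h1, lintegral_smul_measure, hdet, smul_eq_mul, ← mul_assoc, abs_of_pos (by positivity),
    ← ENNReal.ofReal_mul hn.le, mul_inv_cancel₀ hn.ne', ENNReal.ofReal_one, one_mul]

lemma re_det_nonneg {N j : ℕ} (B : Matrix (Fin N) (Fin j) ℂ) : 0 ≤ (Bᴴ * B).det.re := by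
  have := (Matrix.posSemidef_conjTranspose_mul_self B).det_nonneg
  exact (Complex.le_def.1 this).1

lemma measurable_integrand {N j : ℕ} (p q : ℝ) {α : Type} [TopologicalSpace α] [MeasurableSpace α]
    [BorelSpace α] (g : α → Matrix (Fin N) (Fin j) ℂ) (hg : Continuous g) :
    Measurable fun x => ENNReal.ofReal ((((g x)ᴴ * g x).det.re) ^ p * ((1 + (g x)ᴴ * g x).det.re) ^ (-q)) := by
  have h1 : Continuous fun x => ((g x)ᴴ * g x).det.re :=
    Complex.continuous_re.comp ((hg.matrix_conjTranspose.matrix_mul hg).matrix_det)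
  have h2 : Continuous fun x => (1 + (g x)ᴴ * g x).det.re :=
    Complex.continuous_re.comp ((continuous_const.add (hg.matrix_conjTranspose.matrix_mul hg)).matrix_det)
  exact ((h1.measurable.pow_const p).mul (h2.measurable.pow_const (-q))).ennreal_ofReal

lemma inner_integral {N j : ℕ} (p q : ℝ) (hj : j + 1 ≤ N) (hp : 0 < (N:ℝ) - j + p) (hq : 0 < q)
    (hq2 : 0 < q - N - p) (B : Matrix (Fin N) (Fin j) ℂ) :
    ∫⁻ a : Fin N → ℂ, ENNReal.ofReal ((((colCons a B)ᴴ * colCons a B).det.re) ^ p *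
        ((1 + (colCons a B)ᴴ * colCons a B).det.re) ^ (-q)) =
      ENNReal.ofReal (Real.pi ^ N * Real.Gamma (N - j + p) * Real.Gamma (q - N - p) /
        (Real.Gamma (N - j) * Real.Gamma q)) *
      ENNReal.ofReal (((Bᴴ * B).det.re) ^ p * ((1 + Bᴴ * B).det.re) ^ (-(q-1))) := by
  have hjN : (0:ℝ) < (N:ℝ) - j := by
    have : ((j+1 : ℕ):ℝ) ≤ N := by exact_mod_cast hj
    push_cast at this; linarith
  have hG1 := Real.Gamma_pos_of_pos hp
  have hG2 := Real.Gamma_pos_of_pos hq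
  have hG3 := Real.Gamma_pos_of_pos hq2
  have hG4 := Real.Gamma_pos_of_pos hjN
  obtain ⟨L, d, hLL, hLd⟩ := spectral_aux B
  have hg0 := re_det_nonneg B
  have hdetL : (Complex.normSq L.det : ℂ) = (1 + Bᴴ * B).det := by
    rw [Matrix.det_one_add_mul_comm, ← hLL, Matrix.det_mul, Matrix.det_conjTranspose]
    exact (Complex.mul_conj _).symm
  have hne : (1 + Bᴴ * B).det ≠ 0 := by
    have : (1 + Bᴴ * B).PosDef :=
      Matrix.PosDef.one.add_posSemidef (Matrix.posSemidef_conjTranspose_mul_self B)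
    exact this.det_pos.ne'
  have hL : L.det ≠ 0 := by
    intro h; apply hne; rw [← hdetL, h]; simp
  have hn : 0 < Complex.normSq L.det := Complex.normSq_pos.2 hL
  have hre : (1 + Bᴴ * B).det.re = Complex.normSq L.det := by rw [← hdetL, Complex.ofReal_re]
  have hsum : ∀ w : Fin N → ℂ, star w ⬝ᵥ w = ((∑ i, ‖w i‖^2 : ℝ) : ℂ) := by
    intro w
    push_cast
    refine Finset.sum_congr rfl fun i _ => ?_
    exact Complex.conj_mul' _
  have hdet2 : ∀ w : Fin N → ℂ, (1 + (colCons (L *ᵥ w) B)ᴴ * colCons (L *ᵥ w) B).det.re =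
      Complex.normSq L.det * (1 + ∑ i, ‖w i‖^2) := by
    intro w
    have h1 : 1 + colCons (L *ᵥ w) B * (colCons (L *ᵥ w) B)ᴴ = L * (1 + Matrix.vecMulVec w (star w)) * Lᴴ := by
      rw [colCons_mul_conjTranspose, add_left_comm, ← hLL, Matrix.mul_add, Matrix.add_mul, Matrix.mul_one,
        Matrix.star_mulVec, ← Matrix.mul_vecMulVec, ← Matrix.vecMulVec_mul, add_comm, Matrix.mul_assoc L]
    have h2 : (1 + Matrix.vecMulVec w (star w)).det = ((1 + ∑ i, ‖w i‖^2 : ℝ) : ℂ) := by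
      rw [Matrix.vecMulVec_eq Unit, Matrix.det_one_add_replicateCol_mul_replicateRow, hsum]
      push_cast; rfl
    rw [Matrix.det_one_add_mul_comm, h1, Matrix.det_mul, Matrix.det_mul, Matrix.det_conjTranspose, h2,
      mul_right_comm]
    change (L.det * (starRingEnd ℂ) L.det * _).re = _
    rw [Complex.mul_conj, ← Complex.ofReal_mul, Complex.ofReal_re]
  have hmeas : Measurable fun a : Fin N → ℂ => ENNReal.ofReal ((((colCons a B)ᴴ * colCons a B).det.re) ^ p *
        ((1 + (colCons a B)ᴴ * colCons a B).det.re) ^ (-q)) := by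
    refine measurable_integrand p q _ ?_
    refine continuous_matrix fun i k => ?_
    refine Fin.cases ?_ (fun k => ?_) k
    · simp only [colCons, Matrix.of_apply, Fin.cons_zero]; fun_prop
    · simp only [colCons, Matrix.of_apply, Fin.cons_succ]; fun_prop
  rw [lintegral_mulVec L hL _ hmeas]
  have hpow : Complex.normSq L.det * Complex.normSq L.det ^ (-q) = Complex.normSq L.det ^ (-(q-1)) := by
    rw [show -(q-1) = 1 + -q by ring, Real.rpow_add hn, Real.rpow_one]
  -- reduction to the scalar integral
  have key : ∀ (z : Fin N → Prop) [DecidablePred z], 0 < Fintype.card {i // z i} →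
      0 < Fintype.card {i // z i} + p →
      (∀ w : Fin N → ℂ, (((colCons (L *ᵥ w) B)ᴴ * colCons (L *ᵥ w) B).det.re) ^ p =
        ((Bᴴ * B).det.re) ^ p * (∑ i, if z i then ‖w i‖^2 else 0)^p) →
      Real.Gamma (Fintype.card {i // z i} + p) / Real.Gamma (Fintype.card {i // z i}) =
        Real.Gamma (N - j + p) / Real.Gamma (N - j) →
      ENNReal.ofReal (Complex.normSq L.det) * ∫⁻ w : Fin N → ℂ, ENNReal.ofReal ((((colCons (L *ᵥ w) B)ᴴ * colCons (L *ᵥ w) B).det.re) ^ p *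
        ((1 + (colCons (L *ᵥ w) B)ᴴ * colCons (L *ᵥ w) B).det.re) ^ (-q)) =
      ENNReal.ofReal (Real.pi ^ N * Real.Gamma (N - j + p) * Real.Gamma (q - N - p) /
        (Real.Gamma (N - j) * Real.Gamma q)) *
      ENNReal.ofReal (((Bᴴ * B).det.re) ^ p * ((1 + Bᴴ * B).det.re) ^ (-(q-1))) := by
    intro z _ hz hzp hw hGam
    have h3 : ∀ w : Fin N → ℂ, ENNReal.ofReal ((((colCons (L *ᵥ w) B)ᴴ * colCons (L *ᵥ w) B).det.re) ^ p *
        ((1 + (colCons (L *ᵥ w) B)ᴴ * colCons (L *ᵥ w) B).det.re) ^ (-q)) =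
        ENNReal.ofReal (((Bᴴ * B).det.re) ^ p * Complex.normSq L.det ^ (-q)) *
        ENNReal.ofReal ((∑ i, if z i then ‖w i‖^2 else 0)^p * (1 + ∑ i, ‖w i‖^2)^(-q)) := by
      intro w
      rw [hw, hdet2, Real.mul_rpow hn.le (by positivity), ← ENNReal.ofReal_mul (by positivity)]
      congr 1; ring
    simp_rw [h3]
    rw [lintegral_const_mul' _ _ ENNReal.ofReal_ne_top, aux_K z p q hz hzp hq (by simpa using hq2), Fintype.card_fin,
      ← mul_assoc, ← ENNReal.ofReal_mul hn.le, ← ENNReal.ofReal_mul (by positivity),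
      ← ENNReal.ofReal_mul (by positivity), hre, ← hpow]
    congr 1
    rw [show Real.pi ^ N * Real.Gamma (Fintype.card {i // z i} + p) * Real.Gamma (q - N - p) /
      (Real.Gamma (Fintype.card {i // z i}) * Real.Gamma q) = Real.pi ^ N * (Real.Gamma (Fintype.card {i // z i} + p) /
      Real.Gamma (Fintype.card {i // z i})) * Real.Gamma (q - N - p) / Real.Gamma q by
        rw [← div_div]; ring, hGam]
    field_simp
  by_cases hB : (Bᴴ * B).det = 0
  · by_cases hp0 : p = 0
    · subst hp0
      have hN : 0 < N := by omega
      have hN' : (0:ℝ) < N := by exact_mod_cast hN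
      refine key (fun _ => True) (by simpa using hN) (by simpa using hN) (fun w => by simp) ?_
      simp only [add_zero]
      rw [div_self hG4.ne', div_self]
      simpa using (Real.Gamma_pos_of_pos hN').ne'
    · simp [colCons_det_zero _ B hB, hB, Real.zero_rpow hp0]
  · obtain ⟨hcard, hQ⟩ := hLd hB
    have hc : ((Fintype.card {i // d i = 0} : ℕ) : ℝ) = N - j := by
      rw [hcard, Nat.cast_sub (by omega)]
    refine key (fun i => d i = 0) (by omega) (by rw [hc]; exact hp) (fun w => ?_) (by rw [hc])
    have h4 : star (L *ᵥ w) ⬝ᵥ ((1 - B * (Bᴴ * B)⁻¹ * Bᴴ) *ᵥ (L *ᵥ w)) =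
        ((∑ i, if d i = 0 then ‖w i‖^2 else 0 : ℝ) : ℂ) := by
      rw [Matrix.star_mulVec, ← Matrix.dotProduct_mulVec, Matrix.mulVec_mulVec, Matrix.mulVec_mulVec,
        hQ]
      push_cast
      refine Finset.sum_congr rfl fun i _ => ?_
      rw [Matrix.mulVec_diagonal]
      split_ifs
      · rw [one_mul]; exact_mod_cast Complex.conj_mul' (w i)
      · simp
    rw [colCons_det _ B hB, h4, Complex.re_mul_ofReal, Real.mul_rpow hg0]
    exact Finset.sum_nonneg fun i _ => by split_ifs <;> positivity

/-- The integral over function space. -/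
noncomputable def JJ (N j : ℕ) (p q : ℝ) : ENNReal :=
  ∫⁻ A : Fin N → Fin j → ℂ, ENNReal.ofReal ((((Matrix.of A)ᴴ * Matrix.of A).det.re) ^ p *
    ((1 + (Matrix.of A)ᴴ * Matrix.of A).det.re) ^ (-q))

lemma JJ_succ {N j : ℕ} (p q : ℝ) (hj : j + 1 ≤ N) (hp : 0 < (N:ℝ) - j + p) (hq : 0 < q)
    (hq2 : 0 < q - N - p) : JJ N (j+1) p q =
      ENNReal.ofReal (Real.pi ^ N * Real.Gamma (N - j + p) * Real.Gamma (q - N - p) /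
        (Real.Gamma (N - j) * Real.Gamma q)) * JJ N j p (q-1) := by
  have e1 : MeasurePreserving (fun (A : Fin N → Fin (j+1) → ℂ) (i : Fin N) =>
      MeasurableEquiv.piFinSuccAbove (fun _ => ℂ) 0 (A i)) :=
    volume_preserving_pi fun _ => volume_preserving_piFinSuccAbove (fun _ => ℂ) 0
  have e2 := (volume_measurePreserving_arrowProdEquivProdArrow ℂ (Fin j → ℂ) (Fin N)).comp e1
  have hm : Measurable (fun x : (Fin N → ℂ) × (Fin N → Fin j → ℂ) =>
      ENNReal.ofReal ((((colCons x.1 (Matrix.of x.2))ᴴ * colCons x.1 (Matrix.of x.2)).det.re) ^ p *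
        ((1 + (colCons x.1 (Matrix.of x.2))ᴴ * colCons x.1 (Matrix.of x.2)).det.re) ^ (-q))) := by
    refine measurable_integrand p q _ ?_
    refine continuous_matrix fun i k => ?_
    refine Fin.cases ?_ (fun k => ?_) k
    · simp only [colCons, Matrix.of_apply, Fin.cons_zero]; fun_prop
    · simp only [colCons, Matrix.of_apply, Fin.cons_succ]; fun_prop
  have h1 := e2.lintegral_comp hm
  have h2 : JJ N (j+1) p q = ∫⁻ x : (Fin N → ℂ) × (Fin N → Fin j → ℂ),
      ENNReal.ofReal ((((colCons x.1 (Matrix.of x.2))ᴴ * colCons x.1 (Matrix.of x.2)).det.re) ^ p *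
        ((1 + (colCons x.1 (Matrix.of x.2))ᴴ * colCons x.1 (Matrix.of x.2)).det.re) ^ (-q)) := by
    rw [← h1, JJ]
    refine lintegral_congr fun A => ?_
    have : colCons (fun i => A i 0) (Matrix.of fun i k => A i k.succ) = Matrix.of A := by
      ext i k
      refine Fin.cases ?_ (fun k => ?_) k <;> simp [colCons]
    conv_lhs => rw [← this]
    rfl
  rw [h2]
  change ∫⁻ _, _ ∂(Measure.prod volume volume) = _
  rw [lintegral_prod_symm _ hm.aemeasurable, JJ, ← lintegral_const_mul' _ _ ENNReal.ofReal_ne_top]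
  exact lintegral_congr fun B => inner_integral p q hj hp hq hq2 (Matrix.of B)

lemma JJ_eq (N j : ℕ) (p : ℝ) (hj : j ≤ N) (hp : (j:ℝ) < N + p + 1) :
    JJ N j p (N + j + p) = ENNReal.ofReal (∏ m ∈ Finset.Icc 1 j,
      (Real.pi ^ N * Real.Gamma (N - m + 1 + p) * Real.Gamma m / (Real.Gamma (N - m + 1) * Real.Gamma (N + m + p)))) := by
  induction j with
  | zero => simp [JJ, volume_pi, Measure.pi_univ]
  | succ j ih =>
    push_cast at hp
    have h0 : (0:ℝ) ≤ j := Nat.cast_nonneg j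
    have hjN : ((j + 1 : ℕ) : ℝ) ≤ N := by exact_mod_cast hj
    push_cast at hjN
    rw [JJ_succ p _ hj (by linarith) (by push_cast; linarith) (by push_cast; linarith)]
    rw [show (N:ℝ) + (j+1:ℕ) + p - 1 = N + j + p by push_cast; ring, ih (by omega) (by linarith),
      Finset.prod_Icc_succ_top (by omega), mul_comm (Finset.prod _ _), ENNReal.ofReal_mul]
    · congr 2
      push_cast
      rw [show (N:ℝ) - (j+1) + 1 = N - j by ring, show (N:ℝ) + (j + 1) + p - N - p = j + 1 by ring]
    · push_cast
      have g1 := Real.Gamma_pos_of_pos (show 0 < (N:ℝ) - (j+1) + 1 + p by linarith)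
      have g2 := Real.Gamma_pos_of_pos (show 0 < (j:ℝ) + 1 by linarith)
      have g3 := Real.Gamma_pos_of_pos (show 0 < (N:ℝ) - (j+1) + 1 by linarith)
      have g4 := Real.Gamma_pos_of_pos (show 0 < (N:ℝ) + (j+1) + p by linarith)
      positivity

end helpers

theorem moment_integral_affine_chart
    (T M : ℕ) (hT : 0 < T) (hM : 0 < M) (hTM : 2 * M ≤ T)
    (p : ℝ) (hp : 2 * (M : ℝ) - T - 1 < p) :
    ∫⁻ A : Matrix (Fin (T - M)) (Fin M) ℂ,
        ENNReal.ofReal ((((Aᴴ * A).det).re) ^ p *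
          (((1 + Aᴴ * A).det).re) ^ (-((T : ℝ) + p)))
      = ENNReal.ofReal
          ((∏ m ∈ Finset.Icc 1 M,
              (Real.Gamma ((T : ℝ) - m + 1) * Real.Gamma ((T : ℝ) + p - m - M + 1)) /
                (Real.Gamma ((T : ℝ) - m - M + 1) * Real.Gamma ((T : ℝ) + p - m + 1))) *
            (Real.pi ^ (M * (T - M)) *
              ∏ m ∈ Finset.Icc 1 M,
                (Nat.factorial (m - 1) : ℝ) / (Nat.factorial (T - m) : ℝ))) := by
  have hN : ((T - M : ℕ) : ℝ) = T - M := by rw [Nat.cast_sub (by omega)]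
  have h1 := JJ_eq (T - M) M p (by omega) (by rw [hN]; linarith)
  rw [hN, show (T:ℝ) - M + M + p = T + p by ring] at h1
  refine Eq.trans (b := JJ (T - M) M p (T + p)) rfl (h1.trans ?_)
  congr 1
  -- reflect the product of the Gamma functions in the denominator
  have hrefl : ∏ m ∈ Finset.Icc 1 M, Real.Gamma ((T:ℝ) - M + m + p) = ∏ m ∈ Finset.Icc 1 M, Real.Gamma ((T : ℝ) + p - m + 1) := by
    refine Finset.prod_bij' (fun m _ => M + 1 - m) (fun m _ => M + 1 - m) ?_ ?_ ?_ ?_ ?_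
    · intro m hm; rw [Finset.mem_Icc] at *; omega
    · intro m hm; rw [Finset.mem_Icc] at *; omega
    · intro m hm; rw [Finset.mem_Icc] at hm; omega
    · intro m hm; rw [Finset.mem_Icc] at hm; omega
    · intro m hm; rw [Finset.mem_Icc] at hm
      congr 1
      rw [Nat.cast_sub (by omega)]; push_cast; ring
  have hfac : ∀ m ∈ Finset.Icc 1 M, Real.Gamma m = (Nat.factorial (m-1) : ℝ) := by
    intro m hm; rw [Finset.mem_Icc] at hm
    rw [← Real.Gamma_nat_eq_factorial, Nat.cast_sub hm.1]; simp
  have hfac2 : ∏ m ∈ Finset.Icc 1 M, Real.Gamma ((T:ℝ) - m + 1) = ∏ m ∈ Finset.Icc 1 M, (Nat.factorial (T-m) : ℝ) := by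
    refine Finset.prod_congr rfl fun m hm => ?_
    rw [Finset.mem_Icc] at hm
    rw [← Real.Gamma_nat_eq_factorial, Nat.cast_sub (by omega)]
  have hne : ∏ m ∈ Finset.Icc 1 M, (Nat.factorial (T-m) : ℝ) ≠ 0 :=
    Finset.prod_ne_zero_iff.2 fun m _ => by positivity
  simp only [Finset.prod_div_distrib, Finset.prod_mul_distrib, hrefl, hfac2, Finset.prod_const,
    Nat.card_Icc, Nat.add_sub_cancel, ← pow_mul]
  rw [Finset.prod_congr rfl hfac, mul_comm M (T - M)]
  have r1 : ∀ m : ℕ, (T:ℝ) - M - m + 1 + p = T + p - m - M + 1 := fun m => by ring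
  have r2 : ∀ m : ℕ, (T:ℝ) - M - m + 1 = T - m - M + 1 := fun m => by ring
  simp only [r1]
  simp only [r2]
  field_simp
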